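/- arXiv:2101.09315 — 2 statements merged into one kernel-verified Lean document; each statement's English description precedes it below -/
import Mathlib

section
/- Under the conditions of the single-letter Wasserstein bound, if additionally the loss ℓ takes values in [a,b], then |E[gen(W,S)]| ≤ ((b−a)/n) Σ_{i=1}^n E[TV(P_{W|Z_i}, P_W)] ≤ ((b−a)/n) Σ_{i=1}^n E[Ψ(KL(P_{W|Z_i} ‖ P_W))], where Ψ(x) = sqrt(min{x/2, 1 − e^{−x}}). -/
open MeasureTheory ProbabilityTheory
open scoped ENNReal NNReal

noncomputable section

/-- The set of couplings of two measures. -/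
def couplings {X : Type*} [MeasurableSpace X] (P Q : Measure X) : Set (Measure (X × X)) :=
  {μ | μ.map Prod.fst = P ∧ μ.map Prod.snd = Q}

/-- Wasserstein distance of order 1. -/
def W1 {X : Type*} [MeasurableSpace X] [PseudoEMetricSpace X] (P Q : Measure X) : ℝ :=
  (⨅ μ ∈ couplings P Q, ∫⁻ p : X × X, edist p.1 p.2 ∂μ).toReal

variable {Z W : Type*} [MeasurableSpace Z] [MeasurableSpace W]

/-- The law of an i.i.d. dataset of `n` samples from `PZ`. -/
def Pn (PZ : Measure Z) (n : ℕ) : Measure (Fin n → Z) := Measure.pi fun _ => PZ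

/-- Marginal law of the hypothesis `P_W`. -/
def hypLaw (PZ : Measure Z) {n : ℕ} (A : Kernel (Fin n → Z) W) : Measure W :=
  (Pn PZ n).bind fun s => A s

/-- Conditional law `P_{W | Z_i = z}` of the hypothesis given the `i`-th sample. -/
def condLaw (PZ : Measure Z) {n : ℕ} (A : Kernel (Fin n → Z) W) (i : Fin n) (z : Z) :
    Measure W :=
  (Pn PZ n).bind fun s => A (Function.update s i z)

/-- Generalization error `gen(w,s) = E_{Z∼PZ}[ℓ(w,Z)] − (1/n) Σᵢ ℓ(w,sᵢ)`. -/
def gen (PZ : Measure Z) {n : ℕ} (ℓ : W → Z → ℝ) (w : W) (s : Fin n → Z) : ℝ :=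
  (∫ z, ℓ w z ∂PZ) - (1 / (n : ℝ)) * ∑ i, ℓ w (s i)

/-- Expected generalization error `E[gen(W,S)]` under the joint law `P_{W,S}`. -/
def expGen (PZ : Measure Z) {n : ℕ} (A : Kernel (Fin n → Z) W) (ℓ : W → Z → ℝ) : ℝ :=
  ∫ s, ∫ w, gen PZ ℓ w s ∂(A s) ∂(Pn PZ n)

/-- Total variation distance: `sup_A (P(A) - Q(A))`. -/
def tvDist {X : Type*} [MeasurableSpace X] (P Q : Measure X) : ℝ :=
  ⨆ A : Set X, ((P A).toReal - (Q A).toReal)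

/-- Kullback–Leibler divergence `∫ log (dP/dQ) dP`. -/
def klDiv {X : Type*} [MeasurableSpace X] (P Q : Measure X) : ℝ :=
  ∫ x, Real.log ((P.rnDeriv Q x).toReal) ∂P

/-- `Ψ(x) = sqrt(min{x/2, 1 - exp(-x)})`. -/
def Psi (x : ℝ) : ℝ := Real.sqrt (min (x / 2) (1 - Real.exp (-x)))

/-- Positive-part form of the total variation. -/
theorem posPart_eq {X : Type*} [MeasurableSpace X] (P Q : Measure X) [IsProbabilityMeasure P]
    [IsProbabilityMeasure Q] (hac : P ≪ Q) :
    ∫ x, max ((P.rnDeriv Q x).toReal - 1) 0 ∂Q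
      = P.real {x | 1 < (P.rnDeriv Q x).toReal} - Q.real {x | 1 < (P.rnDeriv Q x).toReal} := by
  have hm : Measurable fun x => (P.rnDeriv Q x).toReal :=
    (Measure.measurable_rnDeriv P Q).ennreal_toReal
  have hE : MeasurableSet {x | 1 < (P.rnDeriv Q x).toReal} := measurableSet_lt measurable_const hm
  have hi : Integrable (fun x => (P.rnDeriv Q x).toReal) Q := Measure.integrable_toReal_rnDeriv
  have h1 : ∫ x, max ((P.rnDeriv Q x).toReal - 1) 0 ∂Q
      = ∫ x in {x | 1 < (P.rnDeriv Q x).toReal}, ((P.rnDeriv Q x).toReal - 1) ∂Q := by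
    rw [← integral_indicator hE]
    congr 1
    ext x
    by_cases hx : 1 < (P.rnDeriv Q x).toReal
    · rw [Set.indicator_of_mem (by exact hx), max_eq_left (by linarith)]
    · rw [Set.indicator_of_notMem (by exact hx), max_eq_right (by linarith)]
  rw [h1, integral_sub hi.integrableOn (integrable_const _),
    Measure.setIntegral_toReal_rnDeriv hac]
  simp

theorem integral_sub_le_posPart {X : Type*} [MeasurableSpace X] (P Q : Measure X)
    [IsProbabilityMeasure P] [IsProbabilityMeasure Q] (hac : P ≪ Q) (f : X → ℝ)
    (hf : Measurable f) (a b : ℝ) (hab : ∀ x, f x ∈ Set.Icc a b) :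
    ∫ x, f x ∂P - ∫ x, f x ∂Q ≤ (b - a) * ∫ x, max ((P.rnDeriv Q x).toReal - 1) 0 ∂Q := by
  have hi : Integrable (fun x => (P.rnDeriv Q x).toReal) Q := Measure.integrable_toReal_rnDeriv
  have hfQ : Integrable f Q := Integrable.of_mem_Icc a b hf.aemeasurable (by simpa using ae_of_all Q hab)
  have hfP : Integrable f P := Integrable.of_mem_Icc a b hf.aemeasurable (by simpa using ae_of_all P hab)
  have h1 : ∫ x, (P.rnDeriv Q x).toReal * f x ∂Q = ∫ x, f x ∂P := integral_rnDeriv_smul hac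
  have h2 : Integrable (fun x => (P.rnDeriv Q x).toReal * f x) Q :=
    (integrable_rnDeriv_smul_iff hac).2 hfP
  have h3 : ∫ x, (P.rnDeriv Q x).toReal ∂Q = 1 := by
    rw [Measure.integral_toReal_rnDeriv hac]; simp
  have h4 : ∫ x, f x ∂P - ∫ x, f x ∂Q
      = ∫ x, (((P.rnDeriv Q x).toReal * f x - f x) - a * ((P.rnDeriv Q x).toReal - 1)) ∂Q := by
    have k1 : Integrable (fun x => (P.rnDeriv Q x).toReal * f x - f x) Q := h2.sub hfQ
    have k2 : Integrable (fun x => a * ((P.rnDeriv Q x).toReal - 1)) Q :=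
      (hi.sub (integrable_const _)).const_mul a
    rw [integral_sub k1 k2, integral_sub h2 hfQ, integral_const_mul, integral_sub hi (integrable_const _), h1, h3]
    simp
  rw [h4, ← integral_const_mul]
  apply integral_mono ((h2.sub hfQ).sub ((hi.sub (integrable_const _)).const_mul a))
    (((hi.sub (integrable_const _)).pos_part).const_mul _)
  intro x
  obtain ⟨ha, hb⟩ := hab x
  change ((P.rnDeriv Q x).toReal * f x - f x) - a * ((P.rnDeriv Q x).toReal - 1) ≤
    (b - a) * max ((P.rnDeriv Q x).toReal - 1) 0
  generalize (P.rnDeriv Q x).toReal = r at *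
  calc _ = (f x - a) * (r - 1) := by ring
    _ ≤ (f x - a) * max (r - 1) 0 := mul_le_mul_of_nonneg_left (le_max_left _ _) (by linarith)
    _ ≤ _ := mul_le_mul_of_nonneg_right (by linarith) (le_max_right _ _)

theorem tvDist_eq_posPart {X : Type*} [MeasurableSpace X] (P Q : Measure X)
    [IsProbabilityMeasure P] [IsProbabilityMeasure Q] (hac : P ≪ Q) :
    tvDist P Q = ∫ x, max ((P.rnDeriv Q x).toReal - 1) 0 ∂Q := by
  have hle : ∀ A : Set X, (P A).toReal - (Q A).toReal
      ≤ ∫ x, max ((P.rnDeriv Q x).toReal - 1) 0 ∂Q := by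
    intro A
    have hM := measurableSet_toMeasurable Q A
    have h := integral_sub_le_posPart P Q hac ((toMeasurable Q A).indicator fun _ => (1 : ℝ))
      (measurable_const.indicator hM) 0 1 (fun x => by
        by_cases hx : x ∈ toMeasurable Q A <;> simp [hx])
    rw [integral_indicator_const _ hM, integral_indicator_const _ hM] at h
    simp only [smul_eq_mul, mul_one, sub_zero, one_mul] at h
    have h1 : (Q A).toReal = Q.real (toMeasurable Q A) := by
      rw [measureReal_def, measure_toMeasurable]
    have h2 : (P A).toReal ≤ P.real (toMeasurable Q A) :=
      measureReal_mono (subset_toMeasurable Q A)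
    linarith
  apply le_antisymm
  · exact ciSup_le hle
  · rw [posPart_eq P Q hac]
    exact le_ciSup (f := fun A : Set X => (P A).toReal - (Q A).toReal) ⟨_, by rintro _ ⟨A, rfl⟩; exact hle A⟩
      {x | 1 < (P.rnDeriv Q x).toReal}

theorem abs_integral_sub_le_tvDist {X : Type*} [MeasurableSpace X] (P Q : Measure X)
    [IsProbabilityMeasure P] [IsProbabilityMeasure Q] (hac : P ≪ Q) (f : X → ℝ)
    (hf : Measurable f) (a b : ℝ) (hab : ∀ x, f x ∈ Set.Icc a b) :
    |∫ x, f x ∂P - ∫ x, f x ∂Q| ≤ (b - a) * tvDist P Q := by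
  rw [tvDist_eq_posPart P Q hac, abs_le]
  have h1 := integral_sub_le_posPart P Q hac f hf a b hab
  have h2 := integral_sub_le_posPart P Q hac (fun x => - f x) hf.neg (-b) (-a)
    (fun x => ⟨neg_le_neg (hab x).2, neg_le_neg (hab x).1⟩)
  rw [integral_neg, integral_neg] at h2
  constructor <;> linarith

/-- Bretagnolle-Huber. -/
theorem posPart_bh {X : Type*} [MeasurableSpace X] (P Q : Measure X)
    [IsProbabilityMeasure P] [IsProbabilityMeasure Q] (hac : P ≪ Q)
    (hlog : Integrable (fun x => Real.log ((P.rnDeriv Q x).toReal)) P) (T : ℝ)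
    (hT : T = ∫ x, max ((P.rnDeriv Q x).toReal - 1) 0 ∂Q) :
    T ^ 2 ≤ 1 - Real.exp (-(klDiv P Q)) := by
  have hi : Integrable (fun x => (P.rnDeriv Q x).toReal) Q := Measure.integrable_toReal_rnDeriv
  have h3 : ∫ x, (P.rnDeriv Q x).toReal ∂Q = 1 := by
    rw [Measure.integral_toReal_rnDeriv hac]; simp
  have hil : Integrable (fun x => (P.rnDeriv Q x).toReal * Real.log ((P.rnDeriv Q x).toReal)) Q :=
    (integrable_rnDeriv_smul_iff hac).2 hlog
  have hl : ∫ x, (P.rnDeriv Q x).toReal * Real.log ((P.rnDeriv Q x).toReal) ∂Q = klDiv P Q :=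
    integral_rnDeriv_smul hac
  have hip : Integrable (fun x => max ((P.rnDeriv Q x).toReal - 1) 0) Q :=
    (hi.sub (integrable_const _)).pos_part
  have hT0 : 0 ≤ T := by rw [hT]; exact integral_nonneg fun x => le_max_right _ _
  have hT1 : T ≤ 1 := by
    rw [hT]
    refine le_trans (integral_mono hip hi ?_) h3.le
    intro x
    have : 0 ≤ (P.rnDeriv Q x).toReal := ENNReal.toReal_nonneg
    exact max_le (by linarith) this
  have key : ∀ c d : ℝ, 0 < c → 0 < d →
      - klDiv P Q ≤ (1 - T) / c + (1 + T) / d - 2 + Real.log c + Real.log d := by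
    intro c d hc hd
    have hR : (1 - T) / c + (1 + T) / d - 2 + Real.log c + Real.log d =
      ∫ x, ((-2 + Real.log c + Real.log d + 1 / c) * (P.rnDeriv Q x).toReal + 1 / d
        + (1 / d - 1 / c) * max ((P.rnDeriv Q x).toReal - 1) 0) ∂Q := by
      have k1 : Integrable (fun x => (-2 + Real.log c + Real.log d + 1 / c) *
          (P.rnDeriv Q x).toReal + 1 / d) Q := (hi.const_mul _).add (integrable_const _)
      rw [integral_add k1 (hip.const_mul _),
        integral_add (hi.const_mul _) (integrable_const _), integral_const_mul,
        integral_const_mul, h3, ← hT]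
      simp
      ring
    rw [hR, ← hl, ← integral_neg]
    apply integral_mono hil.neg
      (((hi.const_mul _).add (integrable_const _)).add (hip.const_mul _))
    intro x
    have h0 : 0 ≤ (P.rnDeriv Q x).toReal := ENNReal.toReal_nonneg
    change -((P.rnDeriv Q x).toReal * Real.log ((P.rnDeriv Q x).toReal)) ≤
      (-2 + Real.log c + Real.log d + 1 / c) * (P.rnDeriv Q x).toReal + 1 / d
        + (1 / d - 1 / c) * max ((P.rnDeriv Q x).toReal - 1) 0
    generalize (P.rnDeriv Q x).toReal = r at *
    rcases h0.eq_or_lt with h | h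
    · subst h
      simp [hd.le]
    · have hb : ∀ u e : ℝ, 0 < u → 0 < e → - Real.log u ≤ 1 / (u * e) - 1 + Real.log e := by
        intro u e hu he
        have := Real.log_le_sub_one_of_pos (x := 1 / (u * e)) (by positivity)
        rw [one_div, Real.log_inv, Real.log_mul hu.ne' he.ne'] at this
        rw [one_div]; linarith
      rcases le_total r 1 with hr | hr
      · have h1 := hb r d h hd
        have h2 := hb 1 c one_pos hc
        rw [max_eq_right (by linarith)]
        have h1' := mul_le_mul_of_nonneg_left h1 h0
        have h2' := mul_le_mul_of_nonneg_left h2 h0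
        have e1 : r * (1 / (r * d) - 1 + Real.log d) = 1 / d - r + r * Real.log d := by
          field_simp
        rw [e1] at h1'
        simp at h2' ⊢
        simp at h1'
        nlinarith
      · have h1 := hb r c h hc
        have h2 := hb 1 d one_pos hd
        rw [max_eq_left (by linarith)]
        have h1' := mul_le_mul_of_nonneg_left h1 h0
        have h2' := mul_le_mul_of_nonneg_left h2 h0
        have e1 : r * (1 / (r * c) - 1 + Real.log c) = 1 / c - r + r * Real.log c := by
          field_simp
        rw [e1] at h1'
        simp at h2' ⊢
        simp at h1'
        nlinarith
  rcases hT1.eq_or_lt with h | h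
  · exfalso
    have := key (Real.exp (- klDiv P Q)) 2 (Real.exp_pos _) two_pos
    rw [Real.log_exp, h] at this
    have h2 := Real.log_two_lt_d9
    norm_num at this
    linarith
  · have := key (1 - T) (1 + T) (by linarith) (by linarith)
    rw [div_self (by linarith), div_self (by linarith)] at this
    have h5 : - klDiv P Q ≤ Real.log ((1 - T) * (1 + T)) := by
      rw [Real.log_mul (by linarith) (by linarith)]; linarith
    have h6 := (Real.le_log_iff_exp_le (mul_pos (by linarith) (by linarith))).1 h5
    nlinarith

/-- Pinsker. -/
theorem posPart_pinsker {X : Type*} [MeasurableSpace X] (P Q : Measure X)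
    [IsProbabilityMeasure P] [IsProbabilityMeasure Q] (hac : P ≪ Q)
    (hlog : Integrable (fun x => Real.log ((P.rnDeriv Q x).toReal)) P) (T : ℝ)
    (hT : T = ∫ x, max ((P.rnDeriv Q x).toReal - 1) 0 ∂Q) :
    T ^ 2 ≤ klDiv P Q / 2 := by
  have hi : Integrable (fun x => (P.rnDeriv Q x).toReal) Q := Measure.integrable_toReal_rnDeriv
  have h3 : ∫ x, (P.rnDeriv Q x).toReal ∂Q = 1 := by
    rw [Measure.integral_toReal_rnDeriv hac]; simp
  have hil : Integrable (fun x => (P.rnDeriv Q x).toReal * Real.log ((P.rnDeriv Q x).toReal)) Q :=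
    (integrable_rnDeriv_smul_iff hac).2 hlog
  have hl : ∫ x, (P.rnDeriv Q x).toReal * Real.log ((P.rnDeriv Q x).toReal) ∂Q = klDiv P Q :=
    integral_rnDeriv_smul hac
  have hm : Measurable fun x => (P.rnDeriv Q x).toReal :=
    (Measure.measurable_rnDeriv P Q).ennreal_toReal
  rw [posPart_eq P Q hac] at hT
  have hE : MeasurableSet {x | 1 < (P.rnDeriv Q x).toReal} := measurableSet_lt measurable_const hm
  set E := {x | 1 < (P.rnDeriv Q x).toReal} with hEdef
  let g : X → ℝ := E.indicator fun _ => (1 : ℝ)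
  have hg : Measurable g := measurable_const.indicator hE
  have hgb : ∀ x, g x ∈ Set.Icc (0 : ℝ) 1 := fun x => by
    by_cases hx : x ∈ E <;> simp [g, hx]
  have hgQ : ∫ x, g x ∂Q = Q.real E := by simp [g, integral_indicator_const _ hE]
  have hgP : ∫ x, g x ∂P = P.real E := by simp [g, integral_indicator_const _ hE]
  have hgi : Integrable g P := Integrable.of_mem_Icc 0 1 hg.aemeasurable (ae_of_all P hgb)
  have hsub := hasSubgaussianMGF_of_mem_Icc (μ := Q) hg.aemeasurable (ae_of_all Q hgb)
  have hmgf := hsub.mgf_le (4 * T)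
  have hexp := hsub.integrable_exp_mul (4 * T)
  rw [hgQ] at hmgf hexp
  rw [mgf] at hmgf
  have hconst : (((‖(1 : ℝ) - 0‖₊ / 2) ^ 2 : ℝ≥0) : ℝ) * (4 * T) ^ 2 / 2 = 2 * T ^ 2 := by
    simp; ring
  rw [hconst] at hmgf
  have hrg : Integrable (fun x => (P.rnDeriv Q x).toReal * g x) Q :=
    (integrable_rnDeriv_smul_iff hac).2 hgi
  have hrg' : ∫ x, (P.rnDeriv Q x).toReal * g x ∂Q = P.real E := by
    rw [← hgP]; exact integral_rnDeriv_smul hac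
  have hineq : ∫ x, (4 * T * ((P.rnDeriv Q x).toReal * g x)
      + (1 - 4 * T * Q.real E - 2 * T ^ 2) * (P.rnDeriv Q x).toReal
      - Real.exp (- (2 * T ^ 2)) * Real.exp (4 * T * (g x - Q.real E))) ∂Q
      ≤ ∫ x, (P.rnDeriv Q x).toReal * Real.log ((P.rnDeriv Q x).toReal) ∂Q := by
    apply integral_mono (((hrg.const_mul _).add (hi.const_mul _)).sub (hexp.const_mul _)) hil
    intro x
    have h0 : 0 ≤ (P.rnDeriv Q x).toReal := ENNReal.toReal_nonneg
    change 4 * T * ((P.rnDeriv Q x).toReal * g x)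
      + (1 - 4 * T * Q.real E - 2 * T ^ 2) * (P.rnDeriv Q x).toReal
      - Real.exp (- (2 * T ^ 2)) * Real.exp (4 * T * (g x - Q.real E)) ≤
      (P.rnDeriv Q x).toReal * Real.log ((P.rnDeriv Q x).toReal)
    rw [← Real.exp_add]
    generalize (P.rnDeriv Q x).toReal = r at *
    set t := -(2 * T ^ 2) + 4 * T * (g x - Q.real E) with ht
    have : r * (t + 1) - Real.exp t ≤ r * Real.log r := by
      rcases h0.eq_or_lt with h | h
      · subst h; simp [(Real.exp_pos t).le]
      · have h1 := Real.add_one_le_exp (t - Real.log r)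
        rw [Real.exp_sub, Real.exp_log h, le_div_iff₀ h] at h1
        nlinarith
    calc _ = r * (t + 1) - Real.exp t := by rw [ht]; ring
      _ ≤ _ := this
  have k1 : Integrable (fun x => 4 * T * ((P.rnDeriv Q x).toReal * g x)
      + (1 - 4 * T * Q.real E - 2 * T ^ 2) * (P.rnDeriv Q x).toReal) Q :=
    (hrg.const_mul _).add (hi.const_mul _)
  rw [integral_sub k1 (hexp.const_mul _),
    integral_add (hrg.const_mul _) (hi.const_mul _), integral_const_mul, integral_const_mul,
    integral_const_mul, h3, hrg', hl] at hineq
  have h7 := mul_le_mul_of_nonneg_left hmgf (Real.exp_pos (-(2 * T ^ 2))).le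
  rw [← Real.exp_add] at h7
  simp only [neg_add_cancel, Real.exp_zero] at h7
  have : P.real E = T + Q.real E := by linarith
  rw [this] at hineq
  nlinarith

theorem tvDist_le_Psi {X : Type*} [MeasurableSpace X] (P Q : Measure X)
    [IsProbabilityMeasure P] [IsProbabilityMeasure Q] (hac : P ≪ Q)
    (hlog : Integrable (fun x => Real.log ((P.rnDeriv Q x).toReal)) P) :
    tvDist P Q ≤ Psi (klDiv P Q) := by
  have hT := tvDist_eq_posPart P Q hac
  exact Real.le_sqrt_of_sq_le
    (le_min (posPart_pinsker P Q hac hlog _ hT) (posPart_bh P Q hac hlog _ hT))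

theorem measurePreserving_update_pi (PZ : Measure Z) [IsProbabilityMeasure PZ] (n : ℕ)
    (i : Fin n) :
    MeasurePreserving (fun p : (Fin n → Z) × Z => Function.update p.1 i p.2)
      ((Pn PZ n).prod PZ) (Pn PZ n) := by
  refine ⟨measurable_update', ?_⟩
  symm
  apply Measure.pi_eq
  intro t ht
  rw [Measure.map_apply measurable_update' (MeasurableSet.univ_pi ht)]
  have : (fun p : (Fin n → Z) × Z => Function.update p.1 i p.2) ⁻¹' (Set.univ.pi t)
      = (Set.univ.pi (Function.update t i Set.univ)) ×ˢ (t i) := by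
    ext ⟨s, z⟩
    simp only [Set.mem_preimage, Set.mem_univ_pi, Set.mem_prod]
    constructor
    · intro h
      refine ⟨fun j => ?_, by simpa using h i⟩
      by_cases hj : j = i
      · subst hj; simp
      · simpa [hj] using h j
    · rintro ⟨h1, h2⟩ j
      by_cases hj : j = i
      · subst hj; simpa using h2
      · simpa [hj] using h1 j
  rw [this, Measure.prod_prod, Pn, Measure.pi_pi, ← Finset.mul_prod_erase _ _ (Finset.mem_univ i),
    ← Finset.mul_prod_erase _ (fun j => PZ (t j)) (Finset.mem_univ i), mul_comm]
  simp only [Function.update_self, measure_univ, one_mul]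
  congr 1
  apply Finset.prod_congr rfl
  intro j hj
  rw [Function.update_of_ne (Finset.ne_of_mem_erase hj)]

instance instProbPn (PZ : Measure Z) [IsProbabilityMeasure PZ] (n : ℕ) :
    IsProbabilityMeasure (Pn PZ n) := by unfold Pn; infer_instance

theorem measurable_update_fst (n : ℕ) (i : Fin n) (z : Z) :
    Measurable fun s : Fin n → Z => Function.update s i z :=
  measurable_update'.comp (measurable_id.prodMk measurable_const)

theorem integral_bind_kernel {X Y : Type*} [MeasurableSpace X] [MeasurableSpace Y]
    (μ : Measure X) (κ : Kernel X Y) (f : Y → ℝ) (hf : Integrable f (μ.bind κ)) :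
    ∫ y, f y ∂(μ.bind κ) = ∫ x, ∫ y, f y ∂(κ x) ∂μ := by
  have e : (κ ∘ₖ Kernel.const Unit μ) () = μ.bind κ := by
    rw [Kernel.comp_apply, Kernel.const_apply]
  rw [← e] at hf ⊢
  rw [Kernel.integral_comp hf, Kernel.const_apply]

theorem hypLaw_eq (PZ : Measure Z) {n : ℕ} (A : Kernel (Fin n → Z) W) :
    hypLaw PZ A = (Pn PZ n).bind A := rfl

theorem condLaw_eq (PZ : Measure Z) {n : ℕ} (A : Kernel (Fin n → Z) W) (i : Fin n) (z : Z) :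
    condLaw PZ A i z = (Pn PZ n).bind (A.comap _ (measurable_update_fst n i z)) := rfl

instance instProbHyp (PZ : Measure Z) [IsProbabilityMeasure PZ] {n : ℕ}
    (A : Kernel (Fin n → Z) W) [IsMarkovKernel A] : IsProbabilityMeasure (hypLaw PZ A) := by
  rw [hypLaw_eq]; infer_instance

instance instProbCond (PZ : Measure Z) [IsProbabilityMeasure PZ] {n : ℕ}
    (A : Kernel (Fin n → Z) W) [IsMarkovKernel A] (i : Fin n) (z : Z) :
    IsProbabilityMeasure (condLaw PZ A i z) := by
  rw [condLaw_eq]; infer_instance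

theorem expGen_eq (n : ℕ) (hn : 0 < n) (PZ : Measure Z) [IsProbabilityMeasure PZ]
    (A : Kernel (Fin n → Z) W) [IsMarkovKernel A] (ℓ : W → Z → ℝ) (a b : ℝ)
    (hmeas : Measurable fun p : W × Z => ℓ p.1 p.2)
    (hbdd : ∀ (w : W) (z : Z), ℓ w z ∈ Set.Icc a b) :
    (∀ i, Integrable (fun z => ∫ w, ℓ w z ∂(hypLaw PZ A) - ∫ w, ℓ w z ∂(condLaw PZ A i z)) PZ) ∧
    expGen PZ A ℓ = (1 / (n : ℝ)) * ∑ i,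
      ∫ z, (∫ w, ℓ w z ∂(hypLaw PZ A) - ∫ w, ℓ w z ∂(condLaw PZ A i z)) ∂PZ := by
  have hlz : ∀ z, Measurable fun w => ℓ w z := fun z => hmeas.comp measurable_prodMk_right
  have hil : ∀ (μ : Measure W) [IsProbabilityMeasure μ] (z : Z), Integrable (fun w => ℓ w z) μ :=
    fun μ _ z => Integrable.of_mem_Icc a b (hlz z).aemeasurable (ae_of_all _ fun w => hbdd w z)
  have hav : ∀ {Y : Type _} [MeasurableSpace Y] (μ : Measure Y) [IsProbabilityMeasure μ] (f : Y → ℝ),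
      Measurable f → (∀ y, f y ∈ Set.Icc a b) → ∫ y, f y ∂μ ∈ Set.Icc a b := by
    intro Y _ μ _ f hf hfab
    have hfi : Integrable f μ := Integrable.of_mem_Icc a b hf.aemeasurable (ae_of_all _ hfab)
    constructor
    · simpa using integral_mono (integrable_const a) hfi fun y => (hfab y).1
    · simpa using integral_mono hfi (integrable_const b) fun y => (hfab y).2
  let h : (Fin n → Z) × Z → ℝ := fun p => ∫ w, ℓ w p.2 ∂(A p.1)
  have hh : Measurable h := by
    have : StronglyMeasurable fun q : ((Fin n → Z) × Z) × W => ℓ q.2 q.1.2 :=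
      (hmeas.comp (measurable_snd.prodMk (measurable_snd.comp measurable_fst))).stronglyMeasurable
    exact (this.integral_kernel_prod_right' (κ := A.comap Prod.fst measurable_fst)).measurable
  have hhb : ∀ p, h p ∈ Set.Icc a b := fun p => hav _ _ (hlz _) fun w => hbdd w _
  have hint : ∀ {Y : Type _} [MeasurableSpace Y] (μ : Measure Y) [IsProbabilityMeasure μ]
      (f : Y → (Fin n → Z) × Z), Measurable f → Integrable (fun y => h (f y)) μ := by
    intro Y _ μ _ f hf
    exact Integrable.of_mem_Icc a b (hh.comp hf).aemeasurable (ae_of_all _ fun y => hhb _)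
  have hhyp : ∀ z, ∫ w, ℓ w z ∂(hypLaw PZ A) = ∫ s, h (s, z) ∂(Pn PZ n) := by
    intro z
    have := hil (hypLaw PZ A) z
    rw [hypLaw_eq] at this ⊢
    exact integral_bind_kernel _ _ _ this
  have hcond : ∀ i z, ∫ w, ℓ w z ∂(condLaw PZ A i z)
      = ∫ s, h (Function.update s i z, z) ∂(Pn PZ n) := by
    intro i z
    have := hil (condLaw PZ A i z) z
    rw [condLaw_eq] at this ⊢
    exact integral_bind_kernel _ _ _ this
  have hu : ∀ i : Fin n, Measurable fun p : (Fin n → Z) × Z => (Function.update p.1 i p.2, p.2) :=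
    fun i => measurable_update'.prodMk measurable_snd
  have hG : Integrable (fun z => ∫ s, h (s, z) ∂(Pn PZ n)) PZ :=
    (hint ((Pn PZ n).prod PZ) id measurable_id).integral_prod_right
  have hC : ∀ i, Integrable (fun z => ∫ s, h (Function.update s i z, z) ∂(Pn PZ n)) PZ := fun i =>
    (hint ((Pn PZ n).prod PZ) _ (hu i)).integral_prod_right
  simp_rw [hhyp, hcond]
  refine ⟨fun i => hG.sub (hC i), ?_⟩
  have hCi : ∀ i, ∫ z, ∫ s, h (Function.update s i z, z) ∂(Pn PZ n) ∂PZ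
      = ∫ s, h (s, s i) ∂(Pn PZ n) := by
    intro i
    have hm : Measurable fun s : Fin n → Z => h (s, s i) :=
      hh.comp (measurable_id.prodMk (measurable_pi_apply i))
    have hp := measurePreserving_update_pi PZ n i
    have e1 := integral_map hp.measurable.aemeasurable (μ := (Pn PZ n).prod PZ)
      (f := fun s : Fin n → Z => h (s, s i)) hm.aestronglyMeasurable
    rw [hp.map_eq] at e1
    rw [e1]
    simp only [Function.update_self]
    exact (integral_prod_symm _ (hint ((Pn PZ n).prod PZ) _ (hu i))).symm
  have hinner : ∀ s, ∫ w, gen PZ ℓ w s ∂(A s)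
      = ∫ z, h (s, z) ∂PZ - (1 / (n : ℝ)) * ∑ i, h (s, s i) := by
    intro s
    have hj : Integrable (fun p : W × Z => ℓ p.1 p.2) ((A s).prod PZ) :=
      Integrable.of_mem_Icc a b hmeas.aemeasurable (ae_of_all _ fun p => hbdd _ _)
    have hs : ∀ i ∈ (Finset.univ : Finset (Fin n)), Integrable (fun w => ℓ w (s i)) (A s) :=
      fun i _ => hil (A s) (s i)
    unfold gen
    rw [integral_sub hj.integral_prod_left ((integrable_finsetSum _ hs).const_mul _),
      integral_const_mul, integral_finsetSum _ hs]
    congr 1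
    exact integral_integral_swap hj
  have hsi : ∀ i ∈ (Finset.univ : Finset (Fin n)), Integrable (fun s => h (s, s i)) (Pn PZ n) :=
    fun i _ => hint (Pn PZ n) (fun s => (s, s i)) (measurable_id.prodMk (measurable_pi_apply i))
  have hid : Integrable h ((Pn PZ n).prod PZ) := hint ((Pn PZ n).prod PZ) id measurable_id
  unfold expGen
  simp_rw [hinner]
  rw [integral_sub hid.integral_prod_left ((integrable_finsetSum _ hsi).const_mul _),
    integral_const_mul, integral_finsetSum _ hsi]
  have hsw : ∫ s, ∫ z, h (s, z) ∂PZ ∂(Pn PZ n) = ∫ z, ∫ s, h (s, z) ∂(Pn PZ n) ∂PZ :=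
    integral_integral_swap hid
  have e2 : ∀ i, ∫ z, (∫ s, h (s, z) ∂(Pn PZ n)
      - ∫ s, h (Function.update s i z, z) ∂(Pn PZ n)) ∂PZ
      = ∫ z, ∫ s, h (s, z) ∂(Pn PZ n) ∂PZ - ∫ s, h (s, s i) ∂(Pn PZ n) := by
    intro i
    rw [integral_sub hG (hC i), hCi i]
  simp_rw [e2]
  rw [hsw]
  rw [Finset.sum_sub_distrib, Finset.sum_const, Finset.card_univ, Fintype.card_fin, nsmul_eq_mul,
    mul_sub]
  have : (n : ℝ) ≠ 0 := by positivity
  field_simp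

/-- if the loss is bounded in `[a,b]`, then
`|E[gen(W,S)]| ≤ ((b−a)/n) Σᵢ E[TV(P_{W|Zᵢ}, P_W)]
             ≤ ((b−a)/n) Σᵢ E[Ψ(KL(P_{W|Zᵢ} ‖ P_W))]`. -/
theorem expGen_le_single_letter_tv_le_Psi_kl [MetricSpace W] [PolishSpace W] [BorelSpace W]
    (n : ℕ) (hn : 0 < n) (PZ : Measure Z) [IsProbabilityMeasure PZ]
    (A : Kernel (Fin n → Z) W) [IsMarkovKernel A]
    (ℓ : W → Z → ℝ) (a b : ℝ)
    (hmeas : Measurable fun p : W × Z => ℓ p.1 p.2)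
    (hbdd : ∀ (w : W) (z : Z), ℓ w z ∈ Set.Icc a b)
    (hint2 : Integrable (fun s => ∫ w, gen PZ ℓ w s ∂(A s)) (Pn PZ n))
    (hintTV : ∀ i : Fin n,
      Integrable (fun z => tvDist (condLaw PZ A i z) (hypLaw PZ A)) PZ)
    (hac : ∀ (i : Fin n) (z : Z), condLaw PZ A i z ≪ hypLaw PZ A)
    (hintlog : ∀ (i : Fin n) (z : Z),
      Integrable (fun w => Real.log (((condLaw PZ A i z).rnDeriv (hypLaw PZ A) w).toReal))
        (condLaw PZ A i z))
    (hintKL : ∀ i : Fin n,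
      Integrable (fun z => Psi (klDiv (condLaw PZ A i z) (hypLaw PZ A))) PZ) :
    |expGen PZ A ℓ| ≤
        ((b - a) / n) * ∑ i : Fin n, ∫ z, tvDist (condLaw PZ A i z) (hypLaw PZ A) ∂PZ ∧
      ((b - a) / n) * ∑ i : Fin n, ∫ z, tvDist (condLaw PZ A i z) (hypLaw PZ A) ∂PZ ≤
        ((b - a) / n) *
          ∑ i : Fin n, ∫ z, Psi (klDiv (condLaw PZ A i z) (hypLaw PZ A)) ∂PZ := by
  have hZ : Nonempty Z := PZ.nonempty_of_neZero
  obtain ⟨z0⟩ := hZ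
  have hW : Nonempty W := (hypLaw PZ A).nonempty_of_neZero
  obtain ⟨w0⟩ := hW
  have hab : 0 ≤ b - a := by
    have := hbdd w0 z0
    linarith [this.1, this.2]
  have hn' : (0 : ℝ) < n := by exact_mod_cast hn
  constructor
  · obtain ⟨hI, hE⟩ := expGen_eq n hn PZ A ℓ a b hmeas hbdd
    rw [hE, abs_mul, abs_of_pos (by positivity : (0 : ℝ) < 1 / n), div_eq_mul_one_div (b - a),
      mul_comm (b - a), mul_assoc]
    apply mul_le_mul_of_nonneg_left _ (by positivity)
    rw [Finset.mul_sum]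
    refine (Finset.abs_sum_le_sum_abs _ _).trans (Finset.sum_le_sum fun i _ => ?_)
    refine (abs_integral_le_integral_abs).trans ?_
    rw [← integral_const_mul]
    apply integral_mono (hI i).abs ((hintTV i).const_mul _)
    intro z
    have := abs_integral_sub_le_tvDist (condLaw PZ A i z) (hypLaw PZ A) (hac i z)
      (fun w => ℓ w z) (hmeas.comp measurable_prodMk_right) a b (fun w => hbdd w z)
    rw [abs_sub_comm] at this
    exact this
  · apply mul_le_mul_of_nonneg_left _ (by positivity)
    refine Finset.sum_le_sum fun i _ => integral_mono (hintTV i) (hintKL i) fun z => ?_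
    exact tvDist_le_Psi _ _ (hac i z) (hintlog i z)

end
end

section
/- (Gaussian location model generalization error.) Let Z₁,…,Z_n be i.i.d. N(μ, σ²I_d) in ℝ^d, let W = (1/n)Σᵢ Zᵢ be the empirical mean, and let ℓ(w,z) = ‖w − z‖₂. Then the expected generalization error equals E[gen(W,S)] = sqrt(2σ²/n)·(sqrt(n+1) − sqrt(n−1))·Γ((d+1)/2)/Γ(d/2), and in particular E[gen(W,S)] ≤ sqrt(2σ²d)/n. -/
open MeasureTheory ProbabilityTheory
open scoped ENNReal NNReal

noncomputable section

/-- The Euclidean loss `ℓ(w,z) = ‖w − z‖₂` on `ℝ^d`. -/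
def euclLoss {d : ℕ} (w z : Fin d → ℝ) : ℝ := Real.sqrt (∑ i, (w i - z i) ^ 2)

/-- The Gaussian law `N(μ, σ² I_d)` on `ℝ^d` (independent coordinates). -/
def gaussVec (d : ℕ) (μ : Fin d → ℝ) (σ : ℝ≥0) : Measure (Fin d → ℝ) :=
  Measure.pi fun i => gaussianReal (μ i) (σ ^ 2)

/-- The empirical mean `W = (1/n) Σₖ Zₖ`. -/
def empMean {d n : ℕ} (s : Fin n → Fin d → ℝ) : Fin d → ℝ :=
  fun i => (1 / (n : ℝ)) * ∑ k, s k i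

/-- The expected generalization error of the empirical-mean algorithm in the Gaussian
location model with the Euclidean loss. -/
def expGenGLM (d n : ℕ) (μ : Fin d → ℝ) (σ : ℝ≥0) : ℝ :=
  ∫ s, ((∫ z, euclLoss (empMean s) z ∂(gaussVec d μ σ)) -
      (1 / (n : ℝ)) * ∑ k, euclLoss (empMean s) (s k))
    ∂(Measure.pi fun _ : Fin n => gaussVec d μ σ)

/-- Gaussian vector with variance parameter. -/
def gV (d : ℕ) (m : Fin d → ℝ) (v : ℝ≥0) : Measure (Fin d → ℝ) :=
  Measure.pi fun i => gaussianReal (m i) v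

instance gV_prob (d : ℕ) (m : Fin d → ℝ) (v : ℝ≥0) : IsProbabilityMeasure (gV d m v) := by
  unfold gV; infer_instance

lemma charFunDual_gR (m : ℝ) (v : ℝ≥0) (l : StrongDual ℝ ℝ) :
    charFunDual (gaussianReal m v) l =
      Complex.exp ((l 1 : ℂ) * m * Complex.I - v * (l 1 : ℂ) ^ 2 / 2) := by
  rw [← charFun_gaussianReal, charFunDual_apply, charFun_apply_real]
  congr 1
  ext x
  have : l x = l 1 * x := by
    have := l.map_smul x 1
    simp only [smul_eq_mul, mul_one] at this
    rw [this, mul_comm]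
  rw [this]
  push_cast
  rfl

lemma charFunDual_gV (d : ℕ) (m : Fin d → ℝ) (v : ℝ≥0) (l : StrongDual ℝ (Fin d → ℝ)) :
    charFunDual (gV d m v) l =
      Complex.exp ((∑ i, (l (Pi.single i 1) : ℂ) * m i) * Complex.I -
        v * (∑ i, (l (Pi.single i 1) : ℂ) ^ 2) / 2) := by
  unfold gV
  rw [charFunDual_pi]
  simp_rw [charFunDual_gR]
  rw [← Complex.exp_sum, Finset.sum_sub_distrib, Finset.sum_mul, Finset.mul_sum, Finset.sum_div]
  rfl

/-- Linear combination of independent Gaussian vectors. -/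
lemma gV_comb (d n : ℕ) (m : Fin d → ℝ) (v v' : ℝ≥0) (c : Fin n → ℝ)
    (hv : (v' : ℝ) = (∑ k, c k ^ 2) * v) :
    (Measure.pi fun _ : Fin n => gV d m v).map (fun s i => ∑ k, c k * s k i) =
      gV d (fun i => (∑ k, c k) * m i) v' := by
  let T : (Fin n → Fin d → ℝ) →L[ℝ] (Fin d → ℝ) :=
    ∑ k, c k • ContinuousLinearMap.proj (R := ℝ) (φ := fun _ : Fin n => Fin d → ℝ) k
  have hT : (fun (s : Fin n → Fin d → ℝ) i => ∑ k, c k * s k i) = T := by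
    ext s i
    simp [T]
  rw [hT]
  have : IsProbabilityMeasure ((Measure.pi fun _ : Fin n => gV d m v).map T) :=
    Measure.isProbabilityMeasure_map (by fun_prop)
  refine Measure.ext_of_charFunDual ?_
  ext l
  rw [charFunDual_map, charFunDual_pi, charFunDual_gV]
  simp_rw [charFunDual_gV]
  have key : ∀ k i, ((l.comp T).comp (ContinuousLinearMap.single ℝ (fun _ : Fin n => Fin d → ℝ) k))
      (Pi.single i 1) = c k * l (Pi.single i 1) := by
    intro k i
    have : T (Pi.single k (Pi.single i 1)) = c k • Pi.single i (1:ℝ) := by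
      simp only [T, sum_apply, smul_apply,
        ContinuousLinearMap.proj_apply]
      rw [Finset.sum_eq_single k]
      · simp
      · intro b _ hb
        simp [Pi.single_eq_of_ne hb]
      · simp
    simp only [ContinuousLinearMap.comp_apply, ContinuousLinearMap.single_apply]
    rw [this]; simp
  simp_rw [key]
  rw [← Complex.exp_sum, Finset.sum_sub_distrib]
  have hv2 : (v' : ℂ) = (∑ k, (c k : ℂ) ^ 2) * v := by
    have := congrArg (fun x : ℝ => (x : ℂ)) hv
    push_cast at this
    exact this
  congr 2
  · rw [← Finset.sum_mul]
    congr 1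
    push_cast
    rw [Finset.sum_comm]
    refine Finset.sum_congr rfl fun i _ => ?_
    rw [Finset.sum_mul, Finset.mul_sum]
    refine Finset.sum_congr rfl fun k _ => ?_
    ring
  · rw [hv2, ← Finset.sum_div, ← Finset.mul_sum]
    congr 1
    push_cast
    simp_rw [mul_pow, ← Finset.mul_sum, ← Finset.sum_mul]
    ring

/-- Difference of independent Gaussian vectors. -/
lemma gV_sub (d : ℕ) (m : Fin d → ℝ) (v v' : ℝ≥0) :
    ((gV d m v).prod (gV d m v')).map (fun p => p.1 - p.2) = gV d (fun _ => 0) (v + v') := by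
  let T : (Fin d → ℝ) × (Fin d → ℝ) →L[ℝ] (Fin d → ℝ) :=
    ContinuousLinearMap.fst ℝ _ _ - ContinuousLinearMap.snd ℝ _ _
  have hT : (fun p : (Fin d → ℝ) × (Fin d → ℝ) => p.1 - p.2) = T := by
    ext s i
    simp [T]
  rw [hT]
  have : IsProbabilityMeasure (((gV d m v).prod (gV d m v')).map T) :=
    Measure.isProbabilityMeasure_map (by fun_prop)
  refine Measure.ext_of_charFunDual ?_
  ext l
  rw [charFunDual_map, charFunDual_prod]
  simp_rw [charFunDual_gV]
  rw [← Complex.exp_add]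
  simp [T]
  ring_nf

/-- Scaling. -/
lemma gV_scale (d : ℕ) (v : ℝ≥0) :
    (gV d (fun _ => 0) 1).map (fun x i => Real.sqrt v * x i) = gV d (fun _ => 0) v := by
  unfold gV
  rw [Measure.pi_map_pi (f := fun _ x => Real.sqrt v * x)]
  · congr 1
    ext1 i
    rw [gaussianReal_map_const_mul]
    congr 1
    · simp
    · ext
      simp
  · intro i; fun_prop

lemma gV_density (d : ℕ) :
    gV d (fun _ => 0) 1 = (volume : Measure (Fin d → ℝ)).withDensity
      (fun x => ENNReal.ofReal (∏ i, gaussianPDFReal 0 1 (x i))) := by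
  have hint : Integrable (fun x : Fin d → ℝ => ∏ i, gaussianPDFReal 0 1 (x i)) :=
    Integrable.fintype_prod (f := fun _ : Fin d => gaussianPDFReal 0 1)
      (fun i => integrable_gaussianPDFReal 0 1)
  have hnn : ∀ x : Fin d → ℝ, 0 ≤ ∏ i, gaussianPDFReal 0 1 (x i) :=
    fun x => Finset.prod_nonneg fun i _ => gaussianPDFReal_nonneg 0 1 (x i)
  have hm : Measurable (fun x : Fin d → ℝ => ∏ i, gaussianPDFReal 0 1 (x i)) := by
    fun_prop
  have : IsFiniteMeasure ((volume : Measure (Fin d → ℝ)).withDensity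
      (fun x => ENNReal.ofReal (∏ i, gaussianPDFReal 0 1 (x i)))) :=
    isFiniteMeasure_withDensity_ofReal hint.2
  refine Measure.ext_of_charFunDual ?_
  ext l
  unfold gV
  rw [charFunDual_pi, charFunDual_apply, integral_withDensity_eq_integral_toReal_smul
    (by fun_prop) (by simp)]
  simp_rw [ENNReal.toReal_ofReal (hnn _), charFunDual_apply,
    integral_gaussianReal_eq_integral_smul (one_ne_zero)]
  rw [← integral_fintype_prod_volume_eq_prod]
  congr 1
  ext x
  simp_rw [← l.sum_comp_single, Complex.ofReal_sum, Finset.sum_mul, Complex.exp_sum]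
  simp only [Complex.real_smul]
  rw [Finset.prod_mul_distrib]
  push_cast
  rfl

/-- The Euclidean norm on plain functions. -/
def nrm {d : ℕ} (x : Fin d → ℝ) : ℝ := Real.sqrt (∑ i, x i ^ 2)

lemma prod_pdf (d : ℕ) (x : Fin d → ℝ) : ∏ i, gaussianPDFReal 0 1 (x i) =
    (Real.sqrt (2 * Real.pi))⁻¹ ^ d * Real.exp (-(1/2) * nrm x ^ (2:ℝ)) := by
  simp only [gaussianPDFReal, NNReal.coe_one, mul_one, sub_zero]
  rw [Finset.prod_mul_distrib, ← Real.exp_sum]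
  simp only [Finset.prod_const, Finset.card_univ, Fintype.card_fin]
  congr 2
  rw [Real.rpow_two, nrm, Real.sq_sqrt (Finset.sum_nonneg fun i _ => sq_nonneg _), Finset.mul_sum]
  exact Finset.sum_congr rfl fun i _ => by ring

lemma integral_nrm_vol (d : ℕ) (hd : 0 < d) (f : ℝ → ℝ) :
    ∫ x : Fin d → ℝ, f (nrm x) = d * ((volume : Measure (EuclideanSpace ℝ (Fin d))).real
      (Metric.ball 0 1) * ∫ y in Set.Ioi (0:ℝ), y ^ ((d:ℝ) - 1) * f y) := by
  have : Nontrivial (EuclideanSpace ℝ (Fin d)) := by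
    have : Nonempty (Fin d) := ⟨⟨0, hd⟩⟩
    infer_instance
  have h := integral_fun_norm_addHaar (volume : Measure (EuclideanSpace ℝ (Fin d))) f
  have h2 := (EuclideanSpace.volume_preserving_symm_measurableEquiv_toLp (Fin d)).integral_comp'
    (g := fun x => f (nrm x))
  rw [← h2]
  have h3 : ∀ x : EuclideanSpace ℝ (Fin d),
      nrm ((MeasurableEquiv.toLp 2 (Fin d → ℝ)).symm x) = ‖x‖ := by
    intro x
    rw [EuclideanSpace.norm_eq, nrm]
    simp
  simp_rw [h3]
  rw [h]
  simp only [finrank_euclideanSpace, Fintype.card_fin, smul_eq_mul, nsmul_eq_mul]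
  congr 2
  refine setIntegral_congr_fun measurableSet_Ioi fun y hy => ?_
  have : (d:ℝ) - 1 = ((d - 1 : ℕ) : ℝ) := by
    rw [Nat.cast_sub hd]; simp
  rw [this, Real.rpow_natCast]

lemma integral_gV_std (d : ℕ) (f : ℝ → ℝ) :
    ∫ x, f (nrm x) ∂(gV d (fun _ => 0) 1) = (Real.sqrt (2 * Real.pi))⁻¹ ^ d *
      ∫ x : Fin d → ℝ, Real.exp (-(1/2) * nrm x ^ (2:ℝ)) * f (nrm x) := by
  have hnn : ∀ x : Fin d → ℝ, 0 ≤ ∏ i, gaussianPDFReal 0 1 (x i) :=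
    fun x => Finset.prod_nonneg fun i _ => gaussianPDFReal_nonneg 0 1 (x i)
  rw [gV_density, integral_withDensity_eq_integral_toReal_smul (by fun_prop) (by simp)]
  simp_rw [ENNReal.toReal_ofReal (hnn _), prod_pdf, smul_eq_mul, mul_assoc]
  rw [integral_const_mul]

lemma integral_nrm_std (d : ℕ) (hd : 0 < d) :
    ∫ x, nrm x ∂(gV d (fun _ => 0) 1) =
      Real.sqrt 2 * (Real.Gamma (((d : ℝ) + 1) / 2) / Real.Gamma ((d : ℝ) / 2)) := by
  have hd' : (0:ℝ) < d := by exact_mod_cast hd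
  have h1 := integral_gV_std d (fun _ => 1)
  have h2 := integral_gV_std d (fun y => y)
  rw [integral_nrm_vol d hd (fun y => Real.exp (-(1/2) * y ^ (2:ℝ)) * 1)] at h1
  rw [integral_nrm_vol d hd (fun y => Real.exp (-(1/2) * y ^ (2:ℝ)) * y)] at h2
  have e1 : ∫ y in Set.Ioi (0:ℝ), y ^ ((d:ℝ) - 1) * (Real.exp (-(1/2) * y ^ (2:ℝ)) * 1) =
      (1/2) ^ (-(d:ℝ)/2) * (1/2) * Real.Gamma ((d:ℝ)/2) := by
    simp only [mul_one]
    rw [integral_rpow_mul_exp_neg_mul_rpow (by norm_num) (by linarith) (by norm_num)]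
    simp
  have e2 : ∫ y in Set.Ioi (0:ℝ), y ^ ((d:ℝ) - 1) * (Real.exp (-(1/2) * y ^ (2:ℝ)) * y) =
      (1/2) ^ (-((d:ℝ)+1)/2) * (1/2) * Real.Gamma (((d:ℝ)+1)/2) := by
    rw [← integral_rpow_mul_exp_neg_mul_rpow (by norm_num) (by linarith) (by norm_num)]
    refine setIntegral_congr_fun measurableSet_Ioi fun y hy => ?_
    have hy : (0:ℝ) < y := hy
    have : y ^ (d:ℝ) = y ^ ((d:ℝ) - 1) * y := by
      rw [← Real.rpow_add_one hy.ne']; simp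
    rw [this]; ring
  rw [e1] at h1
  rw [e2] at h2
  have e3 : ((1:ℝ)/2) ^ (-((d:ℝ)+1)/2) = (1/2) ^ (-(d:ℝ)/2) * Real.sqrt 2 := by
    rw [show -((d:ℝ)+1)/2 = -(d:ℝ)/2 + -(1/2) by ring, Real.rpow_add (by norm_num),
      Real.rpow_neg (by norm_num) (1/2), ← Real.sqrt_eq_rpow]
    simp
  rw [e3] at h2
  simp only [integral_const, probReal_univ, smul_eq_mul, mul_one] at h1
  have hG : Real.Gamma ((d:ℝ)/2) ≠ 0 := (Real.Gamma_pos_of_pos (by positivity)).ne'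
  rw [h2, ← mul_div_assoc (Real.sqrt 2), eq_div_iff hG]
  linear_combination (-(Real.sqrt 2 * Real.Gamma (((d : ℝ) + 1) / 2))) * h1

lemma nrm_smul {d : ℕ} (c : ℝ) (hc : 0 ≤ c) (x : Fin d → ℝ) :
    nrm (fun i => c * x i) = c * nrm x := by
  unfold nrm
  simp_rw [mul_pow, ← Finset.mul_sum]
  rw [Real.sqrt_mul (sq_nonneg c), Real.sqrt_sq hc]

lemma nrm_cont {d : ℕ} : Continuous (nrm (d := d)) := by
  unfold nrm; fun_prop

lemma integral_nrm (d : ℕ) (hd : 0 < d) (v : ℝ≥0) :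
    ∫ x, nrm x ∂(gV d (fun _ => 0) v) =
      Real.sqrt v * (Real.sqrt 2 *
        (Real.Gamma (((d : ℝ) + 1) / 2) / Real.Gamma ((d : ℝ) / 2))) := by
  rw [← gV_scale, integral_map (Measurable.aemeasurable (by fun_prop)) nrm_cont.aestronglyMeasurable]
  simp_rw [nrm_smul _ (Real.sqrt_nonneg _)]
  rw [integral_const_mul, integral_nrm_std d hd]

lemma integrable_nrm (d : ℕ) (m : Fin d → ℝ) (v : ℝ≥0) : Integrable nrm (gV d m v) := by
  have h : Integrable (fun x : Fin d → ℝ => ∑ i, |x i|) (gV d m v) := by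
    refine integrable_finset_sum _ fun i _ => ?_
    have h0 : Integrable (fun y : ℝ => |y|) (gaussianReal (m i) v) :=
      (memLp_id_gaussianReal 1).integrable le_rfl |>.abs
    exact (measurePreserving_eval (fun i => gaussianReal (m i) v) i).integrable_comp_of_integrable h0
  refine h.mono' nrm_cont.aestronglyMeasurable (ae_of_all _ fun x => ?_)
  unfold nrm
  rw [Real.norm_of_nonneg (Real.sqrt_nonneg _)]
  refine Real.sqrt_le_iff.2 ⟨Finset.sum_nonneg fun i _ => abs_nonneg _, ?_⟩
  have := Finset.sum_sq_le_sq_sum_of_nonneg (s := Finset.univ) (f := fun i => |x i|) (fun i _ => abs_nonneg _)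
  simpa using this

lemma gamma_ratio (d : ℕ) (hd : 0 < d) :
    Real.Gamma (((d : ℝ) + 1) / 2) / Real.Gamma ((d : ℝ) / 2) ≤ Real.sqrt (d / 2) := by
  have hd' : (0:ℝ) < d := by exact_mod_cast hd
  have hG : 0 < Real.Gamma ((d:ℝ)/2) := Real.Gamma_pos_of_pos (by positivity)
  have h := Real.Gamma_mul_add_mul_le_rpow_Gamma_mul_rpow_Gamma (s := (d:ℝ)/2) (t := (d:ℝ)/2 + 1)
    (a := 1/2) (b := 1/2) (by positivity) (by positivity) (by norm_num) (by norm_num) (by norm_num)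
  rw [Real.Gamma_add_one (by positivity), ← Real.sqrt_eq_rpow, ← Real.sqrt_eq_rpow,
    Real.sqrt_mul (by positivity), mul_comm (Real.sqrt ((d:ℝ)/2)), ← mul_assoc,
    Real.mul_self_sqrt hG.le] at h
  rw [div_le_iff₀ hG, mul_comm]
  have e : ((d:ℝ) + 1) / 2 = 1 / 2 * ((d:ℝ)/2) + 1 / 2 * ((d:ℝ)/2 + 1) := by ring
  rw [e]
  exact h

lemma sqrt_diff (n : ℕ) (hn : 0 < n) :
    Real.sqrt ((n:ℝ) + 1) - Real.sqrt ((n:ℝ) - 1) ≤ Real.sqrt (2 / n) := by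
  have hn' : (1:ℝ) ≤ n := by exact_mod_cast hn
  refine Real.le_sqrt_of_sq_le ?_
  have ha := Real.sq_sqrt (show (0:ℝ) ≤ (n:ℝ) + 1 by linarith)
  have hb := Real.sq_sqrt (show (0:ℝ) ≤ (n:ℝ) - 1 by linarith)
  rw [sub_sq, ha, hb, mul_assoc, ← Real.sqrt_mul (by linarith)]
  have : (n:ℝ) - 1 / n ≤ Real.sqrt (((n:ℝ) + 1) * ((n:ℝ) - 1)) := by
    refine Real.le_sqrt_of_sq_le ?_
    have h1 : (n:ℝ) * (1 / n) = 1 := by field_simp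
    have h2 : (1:ℝ) / n ≤ 1 := by rw [div_le_one (by linarith)]; exact hn'
    have h3 : 0 ≤ (1:ℝ) / n := by positivity
    nlinarith
  have e : (2:ℝ) / n = 2 * (1 / n) := by ring
  rw [e]
  linarith

lemma nrm_meas {d : ℕ} : Measurable (nrm (d := d)) := nrm_cont.measurable

theorem gaussian_location_model_gen (d n : ℕ) (hd : 0 < d) (hn : 0 < n)
    (μ : Fin d → ℝ) (σ : ℝ≥0) (hσ : σ ≠ 0) :
    expGenGLM d n μ σ =
        Real.sqrt (2 * (σ : ℝ) ^ 2 / n) * (Real.sqrt (n + 1) - Real.sqrt (n - 1)) *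
          (Real.Gamma (((d : ℝ) + 1) / 2) / Real.Gamma ((d : ℝ) / 2)) ∧
      expGenGLM d n μ σ ≤ Real.sqrt (2 * (σ : ℝ) ^ 2 * d) / n := by
  have hn' : (1:ℝ) ≤ n := by exact_mod_cast hn
  have hn0 : (0:ℝ) < n := by linarith
  set R := Real.Gamma (((d : ℝ) + 1) / 2) / Real.Gamma ((d : ℝ) / 2) with hR
  have hR0 : 0 ≤ R := div_nonneg (Real.Gamma_nonneg_of_nonneg (by positivity))
    (Real.Gamma_nonneg_of_nonneg (by positivity))
  have hs2 : Real.sqrt (2 * (σ:ℝ)^2 / n) = Real.sqrt 2 * σ / Real.sqrt n := by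
    rw [Real.sqrt_div (by positivity), Real.sqrt_mul (by norm_num), Real.sqrt_sq σ.coe_nonneg]
  have main : expGenGLM d n μ σ =
      Real.sqrt (2 * (σ : ℝ) ^ 2 / n) * (Real.sqrt (n + 1) - Real.sqrt (n - 1)) * R := by
    set P : Measure (Fin n → Fin d → ℝ) := Measure.pi fun _ : Fin n => gV d μ (σ^2) with hP
    have hloss : ∀ w z : Fin d → ℝ, euclLoss w z = nrm (w - z) := fun w z => rfl
    have hg : gaussVec d μ σ = gV d μ (σ^2) := rfl
    have hem : Measurable (empMean (d := d) (n := n)) := by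
      unfold empMean; fun_prop
    -- law of the empirical mean
    have hW : P.map empMean = gV d μ (σ^2 / n) := by
      have h := gV_comb d n μ (σ^2) (σ^2/n) (fun _ => 1/(n:ℝ)) (by
        simp; field_simp)
      have e1 : (fun (s : Fin n → Fin d → ℝ) i => ∑ k, 1/(n:ℝ) * s k i) = empMean := by
        ext s i
        simp only [empMean, Finset.mul_sum]
      have e2 : (fun i => (∑ k : Fin n, 1/(n:ℝ)) * μ i) = μ := by
        ext i
        simp [hn0.ne']
      rw [e1, e2] at h
      exact h
    -- first term
    have hsub := gV_sub d μ (σ^2/n) (σ^2)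
    have hI : Integrable (fun p : (Fin d → ℝ) × (Fin d → ℝ) => nrm (p.1 - p.2))
        ((gV d μ (σ^2/n)).prod (gV d μ (σ^2))) := by
      have := integrable_nrm d (fun _ => 0) (σ^2/n + σ^2)
      rw [← hsub] at this
      exact (integrable_map_measure nrm_cont.aestronglyMeasurable (by fun_prop)).1 this
    have hI1 := hI.integral_prod_left
    have hA1 : Integrable (fun s => ∫ z, nrm (empMean s - z) ∂(gV d μ (σ^2))) P := by
      rw [← hW] at hI1
      exact (integrable_map_measure hI1.1 hem.aemeasurable).1 hI1
    have hA : ∫ s, (∫ z, nrm (empMean s - z) ∂(gV d μ (σ^2))) ∂P =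
        Real.sqrt (σ^2/n + σ^2) * (Real.sqrt 2 * R) := by
      have h1 := integral_nrm d hd (σ^2/n + σ^2)
      rw [← hsub, integral_map (by fun_prop) nrm_cont.aestronglyMeasurable,
        integral_prod _ hI, ← hW, integral_map hem.aemeasurable (by rw [hW]; exact hI1.1)] at h1
      rw [h1]
      simp [hR]
    -- second term
    obtain ⟨v2, hv2⟩ : ∃ v2 : ℝ≥0, (v2 : ℝ) = (σ:ℝ)^2 * (1 - 1/n) :=
      ⟨⟨(σ:ℝ)^2 * (1 - 1/n), mul_nonneg (sq_nonneg _) (by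
        rw [sub_nonneg, div_le_one hn0]; exact hn')⟩, rfl⟩
    have hlaw : ∀ k0 : Fin n, P.map (fun s => empMean s - s k0) =
        gV d (fun _ => 0) v2 := by
      intro k0
      have h := gV_comb d n μ (σ^2) v2
          (fun k => 1/(n:ℝ) - if k = k0 then 1 else 0) (by
        rw [hv2]
        simp only [sub_sq]
        simp [Finset.sum_add_distrib, Finset.sum_sub_distrib]
        field_simp
        ring)
      have e1 : (fun (s : Fin n → Fin d → ℝ) i =>
          ∑ k, (1/(n:ℝ) - if k = k0 then 1 else 0) * s k i) = fun s => empMean s - s k0 := by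
        ext s i
        simp [empMean, Finset.mul_sum, sub_mul, Finset.sum_sub_distrib]
      have e2 : (fun i => (∑ k : Fin n, (1/(n:ℝ) - if k = k0 then 1 else 0)) * μ i) =
          fun _ => 0 := by
        ext i
        simp [hn0.ne', Finset.sum_sub_distrib]
      rw [e1, e2] at h
      exact h
    have hmk : ∀ k0 : Fin n, Measurable (fun s : Fin n → Fin d → ℝ => empMean s - s k0) :=
      fun k0 => hem.sub (measurable_pi_apply k0)
    have hB1 : ∀ k0 : Fin n, Integrable (fun s => nrm (empMean s - s k0)) P := by
      intro k0
      have h := integrable_nrm d (fun _ => 0) v2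
      rw [← hlaw k0] at h
      exact (integrable_map_measure nrm_cont.aestronglyMeasurable (hmk k0).aemeasurable).1 h
    have hB : ∀ k0 : Fin n, ∫ s, nrm (empMean s - s k0) ∂P =
        Real.sqrt (σ^2 * (1 - 1/n)) * (Real.sqrt 2 * R) := by
      intro k0
      have h := integral_nrm d hd v2
      rw [← hlaw k0, integral_map (hmk k0).aemeasurable nrm_cont.aestronglyMeasurable] at h
      rw [h, hv2]
    unfold expGenGLM
    simp_rw [hloss, hg]
    rw [integral_sub hA1 ((integrable_finset_sum _ fun k _ => hB1 k).const_mul _), hA,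
      integral_const_mul, integral_finset_sum _ fun k _ => hB1 k]
    simp_rw [hB]
    have r1 : Real.sqrt ((σ:ℝ)^2/n + (σ:ℝ)^2) = σ * Real.sqrt (n+1) / Real.sqrt n := by
      rw [show (σ:ℝ)^2/n + (σ:ℝ)^2 = (σ:ℝ)^2 * (n+1) / n by field_simp; ring,
        Real.sqrt_div (by positivity), Real.sqrt_mul (by positivity), Real.sqrt_sq σ.coe_nonneg]
    have r2 : Real.sqrt ((σ:ℝ)^2 * (1 - 1/n)) = σ * Real.sqrt (n-1) / Real.sqrt n := by
      rw [show (σ:ℝ)^2 * (1 - 1/n) = (σ:ℝ)^2 * (n-1) / n by field_simp,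
        Real.sqrt_div (mul_nonneg (sq_nonneg _) (by linarith)), Real.sqrt_mul (by positivity),
        Real.sqrt_sq σ.coe_nonneg]
    rw [r1, r2, hs2]
    simp only [Finset.sum_const, Finset.card_univ, Fintype.card_fin, nsmul_eq_mul]
    field_simp
  refine ⟨main, ?_⟩
  rw [main]
  have h1 := sqrt_diff n hn
  have h2 := gamma_ratio d hd
  calc _ ≤ Real.sqrt (2 * (σ : ℝ) ^ 2 / n) * Real.sqrt (2 / n) * Real.sqrt (d/2) := by
        gcongr
    _ = Real.sqrt (2 * (σ : ℝ) ^ 2 * d) / n := by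
        rw [← Real.sqrt_mul (by positivity), ← Real.sqrt_mul (by positivity)]
        rw [show 2 * (σ:ℝ)^2 / n * (2 / n) * (d / 2) = 2 * (σ:ℝ)^2 * d / (n:ℝ)^2 by
          field_simp]
        rw [Real.sqrt_div (by positivity), Real.sqrt_sq hn0.le]

end
end
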